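/- arXiv:1910.06226 — 2 statements merged into one kernel-verified Lean document; each statement's English description precedes it below -/
import Mathlib

section
/- For every natural number n there exists a word W over the 3-letter alphabet {a,b,c} such that W has length at least n, W is square-free, and W is extremal (i.e., no word obtained from W by inserting a single letter at any position is square-free). -/
/-- A word (a list of letters) is square-free if it contains no nonempty
factor of the form `x ++ x`. -/
def SquareFree {α : Type*} (w : List α) : Prop :=
  ∀ x : List α, x ≠ [] → ¬ (x ++ x) <:+: w

/-- A square-free word is extremal if inserting a single letter at any
position never yields a square-free word. -/
def Extremal {α : Type*} (w : List α) : Prop :=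
  SquareFree w ∧ ∀ (w' w'' : List α) (x : α), w = w' ++ w'' →
    ¬ SquareFree (w' ++ x :: w'')

/-- The basic block (length 41). -/
def blk : List (Fin 3) :=
  [0,1,2,0,2,1,2,0,1,0,2,1,0,1,2,1,0,2,0,1,0,2,1,0,1,2,0,2,1,2,0,1,0,2,0,1,2,0,2,1,0]

/-- The block shifted by a letter. -/
def bl (x : Fin 3) : List (Fin 3) := blk.map (fun b => b + x)

def pairW (x y : Fin 3) : List (Fin 3) := bl x ++ bl y

def tri (x y z : Fin 3) : List (Fin 3) := bl x ++ (bl y ++ bl z)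

def preP : List (Fin 3) :=
  [0,2,0,1,2,0,2,1,0,1,2,1,0,2,0,1,2,0,2,1,0,1,2,0,1,0,2,1,2,0,1,2]

def sufS : List (Fin 3) := [1,0,1,2,0,2]

def pre : List (Fin 3) := preP ++ (tri 0 1 2).drop 31

def suf : List (Fin 3) := (tri 2 1 0).take 116 ++ sufS

/-- Do the first `p` letters of two lists exist and agree? -/
def mp : ℕ → List (Fin 3) → List (Fin 3) → Bool
  | 0, _, _ => true
  | p + 1, a :: l, b :: m => (a.val == b.val) && mp p l m
  | _ + 1, _, _ => false

/-- Is there a square of period `p` at position `i`? -/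
def sqAt (l : List (Fin 3)) (i p : ℕ) : Bool := mp p (l.drop i) (l.drop (i + p))

def insL (l : List (Fin 3)) (g : ℕ) (x : Fin 3) : List (Fin 3) := l.take g ++ x :: l.drop g

/-- Squares (offset, period) that block insertions. -/
def pool : List (ℕ × ℕ) := [(1, 1), (0, 1), (0, 2), (3, 2), (4, 3), (1, 3), (5, 3), (7, 4), (1, 4), (10, 6), (9, 6), (2, 6), (20, 11), (2, 11), (17, 12), (23, 12), (0, 12), (11, 13), (15, 13), (10, 13), (3, 21), (44, 23)]

def blockedAt (l : List (Fin 3)) (g : ℕ) (x : Fin 3) : Bool :=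
  pool.any (fun q => Nat.ble q.1 g && sqAt (insL l g x) (g - q.1) q.2)

theorem chk_pair : ∀ x y : Fin 3, x ≠ y → ∀ i < 41, ∀ p < 17,
    sqAt (pairW x y) i (p + 1) = false := by decide +kernel

theorem chk_sync : ∀ x y x' y' : Fin 3, x ≠ y → x' ≠ y' → ∀ r < 41, ∀ r' < r,
    mp 18 ((pairW x y).drop r) ((pairW x' y').drop r') = false := by decide +kernel

theorem chk_mark : ∀ x y : Fin 3, x ≠ y → ∀ r < 41,
    mp 11 (pre.drop 31) ((pairW x y).drop r) = false := by decide +kernel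

theorem chk_mark_suf : ∀ i < 122, mp 11 (pre.drop 31) (suf.drop i) = false := by decide +kernel

theorem chk_mark' : ∀ x y : Fin 3, x ≠ y → ∀ r < 41,
    mp 19 (suf.drop 98) ((pairW x y).drop r) = false := by decide +kernel

theorem chk_pre : ∀ i < 32, ∀ p < 42, sqAt pre i (p + 1) = false := by decide +kernel

theorem chk_suf : ∀ i < 122, ∀ p < 24, sqAt suf i (p + 1) = false := by decide +kernel

theorem chk_ins_pre : ∀ g < 84, ∀ x : Fin 3, blockedAt pre g x = true := by decide +kernel

theorem chk_ins_suf : ∀ g < 82, ∀ x : Fin 3, blockedAt suf (g + 41) x = true := by decide +kernel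

theorem chk_ins_pair : ∀ x y : Fin 3, x ≠ y → ∀ g < 41, ∀ a : Fin 3,
    blockedAt (pairW x y) (g + 21) a = true := by decide +kernel

theorem chk_pair_get : ∀ x y : Fin 3, ∀ j < 82, (pairW x y).getD j 0 =
    blk.getD (j % 41) 0 + (if j < 41 then x else y) := by decide +kernel

theorem chk_pre_get : ∀ j < 92, pre.getD (j + 32) 0 =
    blk.getD ((j + 31) % 41) 0 + blk.getD ((j + 31) / 41) 0 := by decide +kernel

theorem chk_preP_get : ∀ j < 32, pre.getD j 0 = preP.getD j 0 := by decide +kernel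

theorem chk_suf_get : ∀ j < 116, suf.getD j 0 =
    blk.getD (j % 41) 0 + blk.getD (38 + j / 41) 0 := by decide +kernel

theorem chk_sufS_get : ∀ j < 6, suf.getD (116 + j) 0 = sufS.getD j 0 := by decide +kernel

theorem chk_adj : ∀ r < 40, blk.getD r 0 ≠ blk.getD (r + 1) 0 := by decide +kernel

theorem len_pair (x y : Fin 3) : (pairW x y).length = 82 := by
  simp [pairW, bl, blk]

theorem len_pre : pre.length = 124 := by simp [pre, preP, tri, bl, blk]

theorem len_suf : suf.length = 122 := by simp [suf, sufS, tri, bl, blk]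

theorem mp_iff (p : ℕ) : ∀ l m : List (Fin 3), mp p l m = true ↔
    p ≤ l.length ∧ p ≤ m.length ∧ ∀ j < p, l.getD j 0 = m.getD j 0 := by
  induction p with
  | zero => intro l m; simp [mp]
  | succ p ih =>
    intro l m
    cases l with
    | nil => simp [mp]
    | cons a l =>
      cases m with
      | nil => simp [mp]
      | cons b m =>
        simp only [mp, Bool.and_eq_true, beq_iff_eq, ih, List.length_cons]
        constructor
        · rintro ⟨h0, h1, h2, h3⟩
          refine ⟨by omega, by omega, ?_⟩
          intro j hj
          cases j with
          | zero => simpa using Fin.ext h0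
          | succ j => simpa using h3 j (by omega)
        · rintro ⟨h1, h2, h3⟩
          refine ⟨?_, by omega, by omega, ?_⟩
          · have := h3 0 (by omega)
            simp at this
            rw [this]
          · intro j hj
            simpa using h3 (j + 1) (by omega)

theorem getD_drop' (l : List (Fin 3)) (i j : ℕ) : (l.drop i).getD j 0 = l.getD (i + j) 0 := by
  simp [List.getD_eq_getElem?_getD]

theorem mp_drop_iff (p i i' : ℕ) (l m : List (Fin 3)) (hp : 0 < p) :
    mp p (l.drop i) (m.drop i') = true ↔
    i + p ≤ l.length ∧ i' + p ≤ m.length ∧ ∀ j < p, l.getD (i + j) 0 = m.getD (i' + j) 0 := by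
  rw [mp_iff]
  simp only [getD_drop', List.length_drop]
  constructor
  · rintro ⟨a, b, c⟩; exact ⟨by omega, by omega, c⟩
  · rintro ⟨a, b, c⟩; exact ⟨by omega, by omega, c⟩

theorem mp_drop_false {p i i' : ℕ} {l m : List (Fin 3)} (hp : 0 < p)
    (h : mp p (l.drop i) (m.drop i') = false)
    (h1 : i + p ≤ l.length) (h2 : i' + p ≤ m.length)
    (h3 : ∀ j < p, l.getD (i + j) 0 = m.getD (i' + j) 0) : False := by
  have := (mp_drop_iff p i i' l m hp).2 ⟨h1, h2, h3⟩
  rw [h] at this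
  exact Bool.noConfusion this

/-- The infinite fixed point of the morphism. -/
def u (i : ℕ) : Fin 3 :=
  if i = 0 then 0 else blk.getD (i % 41) 0 + u (i / 41)
decreasing_by omega

theorem u_zero : u 0 = 0 := by rw [u]; simp

theorem u_eq (i : ℕ) : u i = blk.getD (i % 41) 0 + u (i / 41) := by
  by_cases h : i = 0
  · subst h
    simp [u_zero, blk]
  · conv_lhs => rw [u]
    simp [h]

theorem u_small (i : ℕ) (hi : i < 41) : u i = blk.getD i 0 := by
  rw [u_eq, Nat.mod_eq_of_lt hi, Nat.div_eq_of_lt hi, u_zero, add_zero]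

theorem u_adj (i : ℕ) : u i ≠ u (i + 1) := by
  induction i using Nat.strong_induction_on with
  | _ i ih =>
    rw [u_eq i, u_eq (i + 1)]
    by_cases h : i % 41 = 40
    · have h1 : (i + 1) % 41 = 0 := by omega
      have h2 : (i + 1) / 41 = i / 41 + 1 := by omega
      rw [h, h1, h2]
      have := ih (i / 41) (by omega)
      simpa [blk] using this
    · have h1 : (i + 1) % 41 = i % 41 + 1 := by omega
      have h2 : (i + 1) / 41 = i / 41 := by omega
      rw [h1, h2]
      intro hh
      exact chk_adj (i % 41) (by omega) (add_right_cancel hh)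

theorem pair_get (k j : ℕ) (hj : j < 82) :
    (pairW (u k) (u (k + 1))).getD j 0 = u (41 * k + j) := by
  rw [chk_pair_get _ _ j hj, u_eq (41 * k + j)]
  have h1 : (41 * k + j) % 41 = j % 41 := by omega
  rw [h1]
  congr 1
  split_ifs with h
  · congr 1; omega
  · congr 1; omega

theorem u_sync_aux (i i' : ℕ) (h : i' % 41 < i % 41)
    (heq : ∀ t < 18, u (i + t) = u (i' + t)) : False := by
  have := chk_sync _ _ _ _ (u_adj (i / 41)) (u_adj (i' / 41)) (i % 41) (by omega) _ h
  refine mp_drop_false (by norm_num) this (by rw [len_pair]; omega) (by rw [len_pair]; omega) ?_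
  intro t ht
  rw [pair_get _ _ (by omega), pair_get _ _ (by omega)]
  have e1 : 41 * (i / 41) + (i % 41 + t) = i + t := by omega
  have e2 : 41 * (i' / 41) + (i' % 41 + t) = i' + t := by omega
  rw [e1, e2]
  exact heq t ht

theorem u_sqfree (p : ℕ) : 0 < p → ∀ i, ¬ ∀ j < p, u (i + j) = u (i + p + j) := by
  induction p using Nat.strong_induction_on with
  | _ p ih =>
    intro hp i hsq
    by_cases hd : p % 41 = 0
    · refine ih (p / 41) (by omega) (by omega) (i / 41) ?_
      intro j hj
      have := hsq (41 * (i / 41 + j) + 40 - i) (by omega)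
      have e1 : i + (41 * (i / 41 + j) + 40 - i) = 41 * (i / 41 + j) + 40 := by omega
      have e2 : i + p + (41 * (i / 41 + j) + 40 - i) = 41 * (i / 41 + p / 41 + j) + 40 := by omega
      rw [e1, e2, u_eq, u_eq (41 * (i / 41 + p / 41 + j) + 40)] at this
      have e3 : (41 * (i / 41 + j) + 40) % 41 = 40 := by omega
      have e4 : (41 * (i / 41 + p / 41 + j) + 40) % 41 = 40 := by omega
      have e5 : (41 * (i / 41 + j) + 40) / 41 = i / 41 + j := by omega
      have e6 : (41 * (i / 41 + p / 41 + j) + 40) / 41 = i / 41 + p / 41 + j := by omega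
      rw [e3, e4, e5, e6] at this
      exact add_left_cancel this
    · by_cases hs : p < 18
      · have := chk_pair _ _ (u_adj (i / 41)) (i % 41) (by omega) (p - 1) (by omega)
        rw [Nat.sub_add_cancel hp] at this
        refine mp_drop_false hp this (by rw [len_pair]; omega) (by rw [len_pair]; omega) ?_
        intro t ht
        rw [pair_get _ _ (by omega), pair_get _ _ (by omega)]
        have e1 : 41 * (i / 41) + (i % 41 + t) = i + t := by omega
        have e2 : 41 * (i / 41) + (i % 41 + p + t) = i + p + t := by omega
        rw [e1, e2]
        exact hsq t ht
      · rcases lt_trichotomy ((i + p) % 41) (i % 41) with h | h | h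
        · exact u_sync_aux i (i + p) h (fun t ht => hsq t (by omega))
        · omega
        · exact u_sync_aux (i + p) i h (fun t ht => (hsq t (by omega)).symm)

/-- The extremal word of length `M`, as a function. -/
def Wf (M i : ℕ) : Fin 3 :=
  if i < 32 then preP.getD i 0 else if i < M - 6 then u (i - 1) else sufS.getD (i - (M - 6)) 0

theorem Wf_mid (M i : ℕ) (h1 : 32 ≤ i) (h2 : i < M - 6) : Wf M i = u (i - 1) := by
  simp [Wf, Nat.not_lt.2 h1, h2]

theorem Wf_pre (M i : ℕ) (hM : 200 ≤ M) (hi : i < 124) : Wf M i = pre.getD i 0 := by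
  by_cases h : i < 32
  · rw [chk_preP_get i h]; simp [Wf, h]
  · obtain ⟨j, rfl⟩ : ∃ j, i = j + 32 := ⟨i - 32, by omega⟩
    rw [Wf_mid M _ (by omega) (by omega), chk_pre_get j (by omega)]
    have : j + 32 - 1 = j + 31 := by omega
    rw [this, u_eq, u_small ((j + 31) / 41) (by omega)]

theorem u_last (n : ℕ) : u (41 ^ n - 1) = 0 := by
  induction n with
  | zero => simp [u_zero]
  | succ n ih =>
    have h0 : 0 < 41 ^ n := by positivity
    rw [u_eq, pow_succ]
    have h1 : (41 ^ n * 41 - 1) % 41 = 40 := by omega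
    have h2 : (41 ^ n * 41 - 1) / 41 = 41 ^ n - 1 := by omega
    rw [h1, h2, ih]
    simp [blk]

theorem u_last3 (n k : ℕ) (hk : k < 3) : u (41 ^ (n + 1) - 3 + k) = blk.getD (38 + k) 0 := by
  have h0 : 0 < 41 ^ n := by positivity
  rw [u_eq, pow_succ]
  have h1 : (41 ^ n * 41 - 3 + k) % 41 = 38 + k := by omega
  have h2 : (41 ^ n * 41 - 3 + k) / 41 = 41 ^ n - 1 := by omega
  rw [h1, h2, u_last, add_zero]

theorem Wf_suf (n j : ℕ) (hj : j < 122) :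
    Wf (41 ^ (n + 2)) (41 ^ (n + 2) - 122 + j) = suf.getD j 0 := by
  have h0 : 0 < 41 ^ n := by positivity
  have hM : 41 ^ (n + 2) = 41 ^ (n + 1) * 41 := pow_succ _ _
  have hM' : 41 ^ (n + 1) = 41 ^ n * 41 := pow_succ _ _
  by_cases h : j < 116
  · rw [Wf_mid _ _ (by omega) (by omega), chk_suf_get j h, u_eq]
    have h1 : (41 ^ (n + 2) - 122 + j - 1) % 41 = j % 41 := by omega
    have h2 : (41 ^ (n + 2) - 122 + j - 1) / 41 = 41 ^ (n + 1) - 3 + j / 41 := by omega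
    rw [h1, h2, u_last3 _ _ (by omega)]
  · obtain ⟨k, rfl⟩ : ∃ k, j = 116 + k := ⟨j - 116, by omega⟩
    rw [chk_sufS_get k (by omega)]
    have e1 : ¬ (41 ^ (n + 2) - 122 + (116 + k) < 32) := by omega
    have e2 : ¬ (41 ^ (n + 2) - 122 + (116 + k) < 41 ^ (n + 2) - 6) := by omega
    have e3 : 41 ^ (n + 2) - 122 + (116 + k) - (41 ^ (n + 2) - 6) = k := by omega
    rw [Wf, if_neg e1, if_neg e2, e3]

/-- A factor avoided by all two-block words is avoided by `u`. -/
theorem u_avoid (q d : ℕ) (l : List (Fin 3)) (hq : 0 < q) (hq' : q ≤ 41) (hl : d + q ≤ l.length)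
    (h : ∀ x y : Fin 3, x ≠ y → ∀ r < 41, mp q (l.drop d) ((pairW x y).drop r) = false)
    (i : ℕ) (heq : ∀ t < q, l.getD (d + t) 0 = u (i + t)) : False := by
  have := h _ _ (u_adj (i / 41)) (i % 41) (by omega)
  refine mp_drop_false hq this hl (by rw [len_pair]; omega) ?_
  intro t ht
  rw [pair_get _ _ (by omega), heq t ht]
  congr 1; omega

theorem Wf_sqfree (n i p : ℕ) (hp : 0 < p) (hi : i + 2 * p ≤ 41 ^ (n + 2))
    (hsq : ∀ j < p, Wf (41 ^ (n + 2)) (i + j) = Wf (41 ^ (n + 2)) (i + p + j)) : False := by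
  have h0 : 0 < 41 ^ n := by positivity
  have hM : 41 ^ (n + 2) = 41 ^ n * 1681 := by rw [pow_add]; norm_num
  have hpre := Wf_pre (41 ^ (n + 2))
  have hsuf := Wf_suf n
  have hmid := Wf_mid (41 ^ (n + 2))
  generalize 41 ^ (n + 2) = M at *
  by_cases h1 : i < 32
  · by_cases h2 : i + p < 42
    · have := chk_pre i h1 (p - 1) (by omega)
      rw [Nat.sub_add_cancel hp] at this
      refine mp_drop_false hp this (by rw [len_pre]; omega) (by rw [len_pre]; omega) ?_
      intro t ht
      rw [← hpre _ (by omega) (by omega), ← hpre _ (by omega) (by omega)]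
      exact hsq t ht
    · -- the marker starting at position 31 recurs at `31 + p`
      have key : ∀ t < 11, pre.getD (31 + t) 0 = Wf M (31 + p + t) := by
        intro t ht
        rw [← hpre _ (by omega) (by omega)]
        have := hsq (31 + t - i) (by omega)
        have e1 : i + (31 + t - i) = 31 + t := by omega
        have e2 : i + p + (31 + t - i) = 31 + p + t := by omega
        rwa [e1, e2] at this
      by_cases h3 : 31 + p + 11 ≤ M - 6
      · refine u_avoid 11 31 pre (by norm_num) (by norm_num) (by rw [len_pre]; norm_num)
          chk_mark (30 + p) ?_
        intro t ht
        rw [key t ht, hmid _ (by omega) (by omega)]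
        congr 1; omega
      · have := chk_mark_suf (31 + p - (M - 122)) (by omega)
        refine mp_drop_false (by norm_num) this (by rw [len_pre]; norm_num)
          (by rw [len_suf]; omega) ?_
        intro t ht
        have e : 31 + p + t = M - 122 + (31 + p - (M - 122) + t) := by omega
        rw [key t ht, e, hsuf _ (by omega)]
  · by_cases h2 : i + 2 * p ≤ M - 6
    · refine u_sqfree p hp (i - 1) ?_
      intro j hj
      have := hsq j hj
      rw [hmid _ (by omega) (by omega), hmid _ (by omega) (by omega)] at this
      have e1 : i + j - 1 = i - 1 + j := by omega
      have e2 : i + p + j - 1 = i - 1 + p + j := by omega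
      rwa [e1, e2] at this
    · by_cases h3 : i + p ≤ M - 24
      · refine u_avoid 19 98 suf (by norm_num) (by norm_num) (by rw [len_suf]; norm_num)
          chk_mark' (M - 24 - p - 1) ?_
        intro t ht
        rw [← hsuf _ (by omega)]
        have := hsq (M - 24 + t - p - i) (by omega)
        have e1 : i + (M - 24 + t - p - i) = M - 24 + t - p := by omega
        have e2 : i + p + (M - 24 + t - p - i) = M - 24 + t := by omega
        rw [e1, e2, hmid _ (by omega) (by omega)] at this
        have e3 : M - 122 + (98 + t) = M - 24 + t := by omega
        rw [e3, ← this]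
        congr 1; omega
      · have := chk_suf (i - (M - 122)) (by omega) (p - 1) (by omega)
        rw [Nat.sub_add_cancel hp] at this
        refine mp_drop_false hp this (by rw [len_suf]; omega) (by rw [len_suf]; omega) ?_
        intro t ht
        rw [← hsuf _ (by omega), ← hsuf _ (by omega)]
        have e1 : M - 122 + (i - (M - 122) + t) = i + t := by omega
        have e2 : M - 122 + (i - (M - 122) + p + t) = i + p + t := by omega
        rw [e1, e2]
        exact hsq t ht

/-- Insertion of a letter, for words given as functions. -/
def insF (v : ℕ → Fin 3) (g : ℕ) (x : Fin 3) (i : ℕ) : Fin 3 :=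
  if i < g then v i else if i = g then x else v (i - 1)

theorem insL_get (l : List (Fin 3)) (g : ℕ) (x : Fin 3) (hg : g ≤ l.length) (i : ℕ) :
    (insL l g x).getD i 0 = insF (fun j => l.getD j 0) g x i := by
  unfold insL insF
  simp only [List.getD_eq_getElem?_getD]
  split_ifs with h1 h2
  · rw [List.getElem?_append_left (by simp; omega), List.getElem?_take_of_lt h1]
  · subst h2
    rw [List.getElem?_append_right (by simp)]
    simp [hg]
  · rw [List.getElem?_append_right (by simp; omega)]
    obtain ⟨k, rfl⟩ : ∃ k, i = g + 1 + k := ⟨i - g - 1, by omega⟩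
    have e : g + 1 + k - (List.take g l).length = k + 1 := by simp [hg]; omega
    rw [e, List.getElem?_cons_succ, List.getElem?_drop]
    congr 2; omega

theorem insL_len (l : List (Fin 3)) (g : ℕ) (x : Fin 3) (hg : g ≤ l.length) :
    (insL l g x).length = l.length + 1 := by
  simp [insL]; omega

theorem pool_pos : ∀ q ∈ pool, 0 < q.2 := by decide

theorem blocked_window (v : ℕ → Fin 3) (s g : ℕ) (l : List (Fin 3)) (x : Fin 3)
    (hg : g ≤ l.length) (hv : ∀ j < l.length, v (s + j) = l.getD j 0)
    (hb : blockedAt l g x = true) :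
    ∃ i p, 0 < p ∧ i + 2 * p ≤ s + l.length + 1 ∧
      ∀ j < p, insF v (s + g) x (i + j) = insF v (s + g) x (i + p + j) := by
  unfold blockedAt at hb
  rw [List.any_eq_true] at hb
  obtain ⟨⟨o, p⟩, hq, hb⟩ := hb
  have hp : 0 < p := pool_pos _ hq
  rw [Bool.and_eq_true] at hb
  obtain ⟨-, hb⟩ := hb
  simp only [sqAt] at hb
  rw [mp_drop_iff _ _ _ _ _ hp, insL_len _ _ _ hg] at hb
  obtain ⟨h1, h2, h3⟩ := hb
  have tr : ∀ k < l.length + 1, insF v (s + g) x (s + k) = (insL l g x).getD k 0 := by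
    intro k hk
    rw [insL_get _ _ _ hg]
    unfold insF
    by_cases c1 : k < g
    · rw [if_pos (by omega), if_pos c1, hv k (by omega)]
    · rw [if_neg (by omega), if_neg c1]
      by_cases c2 : k = g
      · rw [if_pos (by omega), if_pos c2]
      · rw [if_neg (by omega), if_neg c2]
        have e : s + k - 1 = s + (k - 1) := by omega
        rw [e, hv (k - 1) (by omega)]
  refine ⟨s + (g - o), p, hp, by omega, ?_⟩
  intro j hj
  have := h3 j hj
  rw [← tr _ (by omega), ← tr _ (by omega)] at this
  have e1 : s + (g - o) + j = s + (g - o + j) := by omega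
  have e2 : s + (g - o) + p + j = s + (g - o + p + j) := by omega
  rw [e1, e2]
  exact this

theorem Wf_blocked (n g : ℕ) (x : Fin 3) (hg : g ≤ 41 ^ (n + 2)) :
    ∃ i p, 0 < p ∧ i + 2 * p ≤ 41 ^ (n + 2) + 1 ∧
      ∀ j < p, insF (Wf (41 ^ (n + 2))) g x (i + j) =
        insF (Wf (41 ^ (n + 2))) g x (i + p + j) := by
  have h0 : 0 < 41 ^ n := by positivity
  have hM : 41 ^ (n + 2) = 41 ^ n * 1681 := by rw [pow_add]; norm_num
  have hpre := Wf_pre (41 ^ (n + 2))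
  have hsuf := Wf_suf n
  have hmid := Wf_mid (41 ^ (n + 2))
  generalize 41 ^ (n + 2) = M at *
  by_cases h1 : g < 84
  · obtain ⟨i, p, hp, hi, h⟩ := blocked_window (Wf M) 0 g pre x (by rw [len_pre]; omega)
      (by intro j hj; rw [len_pre] at hj; rw [Nat.zero_add]; exact hpre j (by omega) hj)
      (chk_ins_pre g h1 x)
    rw [len_pre] at hi
    rw [Nat.zero_add] at h
    exact ⟨i, p, hp, by omega, h⟩
  · by_cases h2 : M - 81 ≤ g
    · have hc := chk_ins_suf (g - (M - 81)) (by omega) x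
      obtain ⟨i, p, hp, hi, h⟩ := blocked_window (Wf M) (M - 122) _ suf x
        (by rw [len_suf]; omega)
        (by intro j hj; rw [len_suf] at hj; exact hsuf j hj) hc
      rw [len_suf] at hi
      have e : M - 122 + (g - (M - 81) + 41) = g := by omega
      rw [e] at h
      exact ⟨i, p, hp, by omega, h⟩
    · have hc := chk_ins_pair _ _ (u_adj ((g - 22) / 41)) ((g - 22) % 41) (by omega) x
      obtain ⟨i, p, hp, hi, h⟩ := blocked_window (Wf M) (41 * ((g - 22) / 41) + 1) _ _ x
        (by rw [len_pair]; omega)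
        (by
          intro j hj
          rw [len_pair] at hj
          rw [pair_get _ _ hj, hmid _ (by omega) (by omega)]
          congr 1; omega) hc
      rw [len_pair] at hi
      have e : 41 * ((g - 22) / 41) + 1 + ((g - 22) % 41 + 21) = g := by omega
      rw [e] at h
      exact ⟨i, p, hp, by omega, h⟩

theorem not_sqfree_of_square (V : List (Fin 3)) (i p : ℕ) (hp : 0 < p)
    (hi : i + 2 * p ≤ V.length) (h : ∀ j < p, V.getD (i + j) 0 = V.getD (i + p + j) 0) :
    ¬ SquareFree V := by
  intro hV
  refine hV ((V.drop i).take p) ?_ ?_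
  · intro hn
    have := congrArg List.length hn
    simp at this
    omega
  · have e : (V.drop i).take p = (V.drop (i + p)).take p := by
      apply List.ext_getElem?
      intro j
      by_cases hj : j < p
      · rw [List.getElem?_take_of_lt hj, List.getElem?_take_of_lt hj, List.getElem?_drop,
          List.getElem?_drop]
        have := h j hj
        rw [List.getD_eq_getElem _ _ (by omega), List.getD_eq_getElem _ _ (by omega)] at this
        rw [List.getElem?_eq_getElem (by omega), List.getElem?_eq_getElem (by omega), this]
      · rw [List.getElem?_eq_none (by simp; omega), List.getElem?_eq_none (by simp; omega)]
    refine ⟨V.take i, V.drop (i + p + p), ?_⟩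
    nth_rewrite 2 [e]
    have e1 : V.drop (i + p) = (V.drop (i + p)).take p ++ V.drop (i + p + p) := by
      rw [← List.drop_drop (l := V) (i := p) (j := i + p), List.take_append_drop]
    have e2 : V.drop i = (V.drop i).take p ++ V.drop (i + p) := by
      rw [← List.drop_drop (l := V), List.take_append_drop]
    rw [List.append_assoc, List.append_assoc, ← e1, ← e2, List.take_append_drop]

/-- The extremal word as a list. -/
def Wl (n : ℕ) : List (Fin 3) := (List.range (41 ^ (n + 2))).map (Wf (41 ^ (n + 2)))

theorem Wl_len (n : ℕ) : (Wl n).length = 41 ^ (n + 2) := by simp [Wl]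

theorem Wl_get (n i : ℕ) (hi : i < 41 ^ (n + 2)) :
    (Wl n).getD i 0 = Wf (41 ^ (n + 2)) i := by
  rw [List.getD_eq_getElem _ _ (by rw [Wl_len]; exact hi)]
  simp [Wl]

theorem Wl_sqfree (n : ℕ) : SquareFree (Wl n) := by
  rintro x hx ⟨s, t, hst⟩
  have hp : 0 < x.length := List.length_pos_iff.2 hx
  have hl := congrArg List.length hst
  rw [Wl_len] at hl
  simp only [List.length_append] at hl
  refine Wf_sqfree n s.length x.length hp (by omega) ?_
  intro j hj
  rw [← Wl_get n _ (by omega), ← Wl_get n _ (by omega), ← hst]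
  simp only [List.getD_eq_getElem?_getD]
  congr 1
  have e : s ++ (x ++ x) ++ t = s ++ (x ++ (x ++ t)) := by simp
  have a1 : (s ++ (x ++ (x ++ t)))[s.length + j]? = x[j]? := by
    rw [List.getElem?_append_right (Nat.le_add_right _ _), Nat.add_sub_cancel_left,
      List.getElem?_append_left hj]
  have a2 : (s ++ (x ++ (x ++ t)))[s.length + (x.length + j)]? = x[j]? := by
    rw [List.getElem?_append_right (Nat.le_add_right _ _), Nat.add_sub_cancel_left,
      List.getElem?_append_right (Nat.le_add_right _ _), Nat.add_sub_cancel_left,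
      List.getElem?_append_left hj]
  rw [e, Nat.add_assoc, a1, a2]

theorem Wl_extremal (n : ℕ) : Extremal (Wl n) := by
  refine ⟨Wl_sqfree n, ?_⟩
  intro w' w'' x hw
  have hl := congrArg List.length hw
  rw [Wl_len, List.length_append] at hl
  obtain ⟨i, p, hp, hi, h⟩ := Wf_blocked n w'.length x (by omega)
  have e : w' ++ x :: w'' = insL (Wl n) w'.length x := by simp [insL, hw]
  have hg : w'.length ≤ (Wl n).length := by rw [Wl_len]; omega
  rw [e]
  refine not_sqfree_of_square _ i p hp (by rw [insL_len _ _ _ hg, Wl_len]; exact hi) ?_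
  have tr : ∀ k < 41 ^ (n + 2) + 1, (insL (Wl n) w'.length x).getD k 0 =
      insF (Wf (41 ^ (n + 2))) w'.length x k := by
    intro k hk
    rw [insL_get _ _ _ hg]
    unfold insF
    split_ifs with c1 c2
    · exact Wl_get n k (by omega)
    · rfl
    · exact Wl_get n (k - 1) (by omega)
  intro j hj
  rw [tr _ (by omega), tr _ (by omega)]
  exact h j hj

/-- There exist arbitrarily long extremal square-free words over a
3-letter alphabet. -/
theorem arbitrarily_long_extremal_words (n : ℕ) :
    ∃ W : List (Fin 3), n ≤ W.length ∧ SquareFree W ∧ Extremal W := by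
  refine ⟨Wl n, ?_, Wl_sqfree n, Wl_extremal n⟩
  rw [Wl_len]
  have h1 : n < 41 ^ n := Nat.lt_pow_self (by norm_num)
  have h2 : 41 ^ n ≤ 41 ^ (n + 2) := Nat.pow_le_pow_right (by norm_num) (by omega)
  omega
end

section
/- For every natural number n there exists a word W over the 3-letter alphabet {a,b,c} such that W has length at least n, W is square-free, and W is nearly extremal, i.e., every square-free extension of W is of the form xW or Wx for some letter x (equivalently, inserting a single letter at any position strictly inside W never yields a square-free word). -/
/-- A square-free word is nearly extremal if inserting a single letter at
any position strictly inside the word never yields a square-free word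
(so every square-free extension is of the form `xW` or `Wx`). -/
def NearlyExtremal {α : Type*} (w : List α) : Prop :=
  SquareFree w ∧ ∀ (w' w'' : List α) (x : α), w = w' ++ w'' →
    w' ≠ [] → w'' ≠ [] → ¬ SquareFree (w' ++ x :: w'')

def ltA : Fin 3 := ⟨0, by decide⟩

/-! The proof uses a 43-uniform square-free morphism `hm` such that the images share the
prefix `mkr`, and each `hm a ++ mkr` is already nearly extremal. -/

/-- Second letter. -/
def ltB : Fin 3 := ⟨1, by decide⟩

/-- Third letter. -/
def ltC : Fin 3 := ⟨2, by decide⟩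

/-- The 43-uniform morphism. -/
def hm (a : Fin 3) : List (Fin 3) :=
  match a with
  | 0 => 
    [ltA, ltB, ltC, ltA, ltB, ltA, ltC, ltB, ltC, ltA, ltB, ltC, ltB, ltA, ltB, ltC, ltA, ltC,
     ltB, ltC, ltA, ltB, ltC, ltB, ltA, ltC, ltA, ltB, ltA, ltC, ltB, ltC, ltA, ltB, ltC, ltB,
     ltA, ltC, ltB, ltC, ltA, ltC, ltB]
  | 1 => 
    [ltA, ltB, ltC, ltA, ltB, ltA, ltC, ltB, ltC, ltA, ltB, ltC, ltB, ltA, ltB, ltC, ltA, ltC,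
     ltB, ltC, ltA, ltB, ltC, ltB, ltA, ltC, ltA, ltB, ltC, ltA, ltC, ltB, ltC, ltA, ltB, ltA,
     ltC, ltA, ltB, ltC, ltA, ltC, ltB]
  | 2 => 
    [ltA, ltB, ltC, ltA, ltB, ltA, ltC, ltB, ltC, ltA, ltB, ltC, ltB, ltA, ltC, ltA, ltB, ltC,
     ltA, ltC, ltB, ltA, ltC, ltA, ltB, ltC, ltB, ltA, ltC, ltB, ltC, ltA, ltB, ltC, ltB, ltA,
     ltC, ltA, ltB, ltC, ltA, ltC, ltB]

/-- The marker, a common prefix of the images of the morphism. -/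
def mkr : List (Fin 3) := [ltA, ltB, ltC, ltA, ltB, ltA]

/-- Forces evaluation of a letter (in continuation-passing style). -/
def forceL (a : Fin 3) (k : Fin 3 → Bool) : Bool :=
  match Nat.beq a.val 0 with
  | true => k ltA
  | false => match Nat.beq a.val 1 with
    | true => k ltB
    | false => k ltC

theorem forceL_eq (a : Fin 3) (k : Fin 3 → Bool) : forceL a k = k a := by
  fin_cases a <;> rfl

/-- Forces evaluation of a word (in continuation-passing style). -/
def forceW : List (Fin 3) → (List (Fin 3) → Bool) → Bool
  | [], k => k []
  | a :: l, k => forceL a fun b => forceW l fun l' => k (b :: l')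

theorem forceW_eq (l : List (Fin 3)) (k : List (Fin 3) → Bool) : forceW l k = k l := by
  induction l generalizing k with
  | nil => rfl
  | cons a l ih => rw [forceW, forceL_eq, ih]

/-- Do the first `k.length` letters of both words exist and agree? -/
noncomputable def agr (k : List (Fin 3)) : List (Fin 3) → List (Fin 3) → Bool :=
  List.rec (motive := fun _ => List (Fin 3) → List (Fin 3) → Bool) (fun _ _ => true)
    (fun _ _ ih l m =>
      List.rec (motive := fun _ => Bool) false
        (fun a l' _ => List.rec (motive := fun _ => Bool) false
          (fun b m' _ => Bool.rec (motive := fun _ => Bool) false (ih l' m')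
            (Nat.beq a.val b.val)) m) l) k

theorem agr_cons (c a b : Fin 3) (k l m : List (Fin 3)) :
    agr (c :: k) (a :: l) (b :: m) =
      match Nat.beq a.val b.val with
      | true => agr k l m
      | false => false := by
  change Bool.rec (motive := fun _ => Bool) false (agr k l m) (Nat.beq a.val b.val) = _
  cases Nat.beq a.val b.val <;> rfl

theorem agr_iff (k l m : List (Fin 3)) :
    agr k l m = true ↔ k.length ≤ l.length ∧ k.length ≤ m.length ∧
      l.take k.length = m.take k.length := by
  induction k generalizing l m with
  | nil => simp [agr]
  | cons c k ih =>
    cases l with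
    | nil => simp [agr]
    | cons a l =>
      cases m with
      | nil => simp [agr]
      | cons b m =>
        simp only [agr_cons, List.length_cons, List.take_succ_cons, List.cons.injEq]
        cases h : Nat.beq a.val b.val with
        | true =>
          have hab : a = b := Fin.ext (Nat.eq_of_beq_eq_true h)
          simp [ih, hab]
        | false =>
          have hab : a ≠ b := fun e => Nat.ne_of_beq_eq_false h (congrArg Fin.val e)
          simp [hab]

/-- Suppose `m = l.drop k.length`: is there a square prefix of `l` of half-length at
least `k.length`? -/
noncomputable def sqPre (l : List (Fin 3)) (m : List (Fin 3)) : List (Fin 3) → Bool :=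
  List.rec (motive := fun _ => List (Fin 3) → Bool) (fun _ => false)
    (fun b m ih k => Bool.rec (motive := fun _ => Bool) (ih (b :: k)) true
      (agr k l (b :: m))) m

theorem sqPre_cons (l m k : List (Fin 3)) (b : Fin 3) :
    sqPre l (b :: m) k =
      match agr k l (b :: m) with
      | true => true
      | false => sqPre l m (b :: k) := by
  change Bool.rec (motive := fun _ => Bool) (sqPre l m (b :: k)) true (agr k l (b :: m)) = _
  cases agr k l (b :: m) <;> rfl

theorem sqPre_iff (l m k : List (Fin 3)) (p : ℕ) (hk : k.length = p) (hm : m = l.drop p) (hp : 0 < p) :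
    sqPre l m k = true ↔
      ∃ q, p ≤ q ∧ 2 * q ≤ l.length ∧ l.take q = (l.drop q).take q := by
  induction m generalizing k p with
  | nil =>
    have := congrArg List.length hm
    simp only [List.length_nil, List.length_drop] at this
    constructor
    · intro h; simp [sqPre] at h
    · rintro ⟨q, h1, h2, -⟩; omega
  | cons b m ih =>
    have hm' : m = l.drop (p + 1) := by
      rw [← List.drop_drop, ← hm]; rfl
    have ih' := ih (b :: k) (p + 1) (by simp [hk]) hm' (by omega)
    have ha := agr_iff k l (b :: m)
    rw [hk, hm, List.length_drop] at ha
    rw [sqPre_cons, hm]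
    cases h : agr k l (l.drop p) with
    | true =>
      rw [h] at ha
      obtain ⟨h1, h2, h3⟩ := ha.mp rfl
      simp only [true_iff]
      exact ⟨p, le_rfl, by omega, h3⟩
    | false =>
      rw [h] at ha
      simp only
      rw [ih']
      constructor
      · rintro ⟨q, h1, h2⟩
        exact ⟨q, by omega, h2⟩
      · rintro ⟨q, h1, h2, h3⟩
        refine ⟨q, ?_, h2, h3⟩
        rcases Nat.lt_or_ge p q with h4 | h4
        · exact h4
        · obtain rfl : q = p := by omega
          exact absurd (ha.mpr ⟨by omega, by omega, h3⟩) (by simp)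

/-- Is there a square starting at one of the first `n` positions? -/
noncomputable def hasSqN : ℕ → List (Fin 3) → Bool
  | 0, _ => false
  | _ + 1, [] => false
  | n + 1, a :: l => match sqPre (a :: l) l [a] with
    | true => true
    | false => hasSqN n l

theorem hasSqN_iff (n : ℕ) (w : List (Fin 3)) : hasSqN n w = true ↔
    ∃ s, s < n ∧ ∃ q, 0 < q ∧ s + 2 * q ≤ w.length ∧
      (w.drop s).take q = (w.drop (s + q)).take q := by
  induction n generalizing w with
  | zero => simp [hasSqN]
  | succ n ih =>
    cases w with
    | nil =>
      simp only [hasSqN, List.length_nil]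
      constructor
      · intro h; simp at h
      · rintro ⟨s, -, q, h1, h2, -⟩; omega
    | cons a l =>
      have h := sqPre_iff (a :: l) l [a] 1 rfl rfl (by omega)
      rw [hasSqN]
      cases hb : sqPre (a :: l) l [a] with
      | true =>
        obtain ⟨q, h1, h2, h3⟩ := h.mp hb
        simp only [true_iff]
        exact ⟨0, by omega, q, h1, by omega, by simpa using h3⟩
      | false =>
        simp only
        rw [ih]
        constructor
        · rintro ⟨s, hs, q, h1, h2, h3⟩
          refine ⟨s + 1, by omega, q, h1, by simp only [List.length_cons]; omega, ?_⟩
          rw [show s + 1 + q = (s + q) + 1 by omega]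
          exact h3
        · rintro ⟨s, hs, q, h1, h2, h3⟩
          cases s with
          | zero =>
            have := h.mpr ⟨q, h1, by omega, by simpa using h3⟩
            rw [hb] at this
            simp at this
          | succ s =>
            refine ⟨s, by omega, q, h1, by simp only [List.length_cons] at h2; omega, ?_⟩
            rw [show s + 1 + q = (s + q) + 1 by omega] at h3
            exact h3

theorem hasSq_sound {n : ℕ} {w : List (Fin 3)} (h : hasSqN n w = true) : ¬ SquareFree w := by
  intro hw
  obtain ⟨s, -, p, hp, hl, heq⟩ := (hasSqN_iff n w).mp h
  refine hw ((w.drop s).take p) ?_ ?_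
  · intro h0
    have := congrArg List.length h0
    simp at this
    omega
  · have h2 : (w.drop s).take p ++ (w.drop s).take p = (w.drop s).take (p + p) := by
      rw [List.take_add, List.drop_drop, ← heq]
    rw [h2]
    exact (List.take_prefix _ _).isInfix.trans (List.drop_suffix _ _).isInfix

theorem SquareFree.of_infix {w v : List (Fin 3)} (h : SquareFree w) (hv : v <:+: w) :
    SquareFree v := fun x hx hxx => h x hx (hxx.trans hv)

/-! ### Finite checks -/

theorem hm_length (a : Fin 3) : (hm a).length = 43 := by
  revert a; decide +kernel

theorem em_prefix (a : Fin 3) : mkr <+: hm a := by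
  revert a; decide +kernel

/-- Boolean test: inserting `x` between `pre.reverse ++ [a]` and `b :: w` creates a square. -/
noncomputable def insAt (x a b : Fin 3) (pre w : List (Fin 3)) : Bool :=
  match Nat.beq x.val a.val with
  | true => true
  | false => match Nat.beq x.val b.val with
    | true => true
    | false => forceW ((a :: pre).reverse ++ x :: b :: w) (hasSqN 60)

theorem insAt_sound {x a b : Fin 3} {pre w : List (Fin 3)} (h : insAt x a b pre w = true) :
    ¬ SquareFree ((a :: pre).reverse ++ x :: b :: w) := by
  rw [insAt] at h
  cases h1 : Nat.beq x.val a.val with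
  | true =>
    obtain rfl : x = a := Fin.ext (Nat.eq_of_beq_eq_true h1)
    exact fun hs => hs [x] (by simp) ⟨pre.reverse, b :: w, by simp⟩
  | false =>
    cases h2 : Nat.beq x.val b.val with
    | true =>
      obtain rfl : x = b := Fin.ext (Nat.eq_of_beq_eq_true h2)
      exact fun hs => hs [x] (by simp) ⟨(a :: pre).reverse, w, by simp⟩
    | false =>
      simp only [h1, h2, forceW_eq] at h
      exact hasSq_sound h

/-- Boolean test: every insertion into `pre.reverse ++ w` at a gap to the right of the first
letter of `w` and before its last letter creates a square. -/
noncomputable def insCheck (x : Fin 3) : List (Fin 3) → List (Fin 3) → Bool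
  | _, [] => true
  | pre, a :: w => match w with
    | [] => true
    | b :: w' => match insAt x a b pre w' with
      | true => insCheck x (a :: pre) (b :: w')
      | false => false

theorem insCheck_sound (x : Fin 3) (pre w : List (Fin 3)) (h : insCheck x pre w = true) (c : ℕ)
    (hc : 0 < c) (hc' : c < w.length) :
    ¬ SquareFree (pre.reverse ++ (w.take c ++ x :: w.drop c)) := by
  induction w generalizing pre c with
  | nil => simp at hc'
  | cons a w ih =>
    cases w with
    | nil => simp at hc'; omega
    | cons b w' =>
      rw [insCheck] at h
      cases hb : insAt x a b pre w' with
      | false => rw [hb] at h; simp at h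
      | true =>
        rw [hb] at h
        simp only at h
        obtain ⟨c, rfl⟩ : ∃ d, c = d + 1 := ⟨c - 1, by omega⟩
        cases c with
        | zero =>
          have := insAt_sound hb
          simpa using this
        | succ c =>
          have := ih (a :: pre) h (c + 1) (by omega) (by simpa using hc')
          simpa using this

theorem hm_ext_check : ∀ a : Fin 3, ∀ x : Fin 3, insCheck x [] (hm a ++ mkr) = true := by
  decide +kernel

theorem short_check : ∀ a b c d : Fin 3, ∀ t < 5,
    hasSqN 4 ([a, b, c, d].take t) = true ∨
      forceW (([a, b, c, d].take t).flatMap hm) (hasSqN 43) = false := by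
  decide +kernel

/-- Letter `r` of the image of `a`. -/
def gm (a : Fin 3) (r : ℕ) : Fin 3 := (hm a).getD r 0

theorem gm_prefix_inj : ∀ a b : Fin 3, (∀ i < 29, gm a i = gm b i) → a = b := by
  decide +kernel

theorem gm_suffix_inj : ∀ a b : Fin 3, (∀ i < 43, 29 ≤ i → gm a i = gm b i) → a = b := by
  decide +kernel

theorem gm_em : ∀ a : Fin 3, ∀ i < 6, gm a i = mkr.getD i 0 := by
  decide +kernel

theorem gm_sync : ∀ a b : Fin 3, ∀ r < 43,
    (∀ i < 6, (if r + i < 43 then gm a (r + i) else gm b (r + i - 43)) = mkr.getD i 0) →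
    r = 0 := by
  decide +kernel

/-! ### Index form of square-freeness -/

theorem SquareFree.index {w : List (Fin 3)} (h : SquareFree w) (s p : ℕ) (hp : 0 < p)
    (hs : s + 2 * p ≤ w.length) (heq : ∀ i < p, w.getD (s + i) 0 = w.getD (s + p + i) 0) :
    False := by
  have hx : (w.drop s).take p = (w.drop (s + p)).take p := by
    apply List.ext_getElem
    · simp; omega
    · intro i h1 h2
      simp only [List.length_take, List.length_drop] at h1 h2
      have := heq i (by omega)
      rw [List.getD_eq_getElem _ _ (by omega), List.getD_eq_getElem _ _ (by omega)] at this
      simpa using this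
  refine h ((w.drop s).take p) ?_ ?_
  · intro h0
    have := congrArg List.length h0
    simp at this
    omega
  · have h2 : (w.drop s).take p ++ (w.drop s).take p = (w.drop s).take (p + p) := by
      rw [List.take_add, List.drop_drop, ← hx]
    rw [h2]
    exact (List.take_prefix _ _).isInfix.trans (List.drop_suffix _ _).isInfix

theorem exists_index {w : List (Fin 3)} {x : List (Fin 3)} (hx : x ≠ []) (h : x ++ x <:+: w) :
    ∃ s p, 0 < p ∧ s + 2 * p ≤ w.length ∧
      ∀ i < p, w.getD (s + i) 0 = w.getD (s + p + i) 0 := by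
  obtain ⟨a, b, rfl⟩ := h
  refine ⟨a.length, x.length, List.length_pos_iff.mpr hx, by simp; omega, ?_⟩
  intro i hi
  simp only [List.getD_eq_getElem?_getD]
  congr 1
  simp only [List.append_assoc]
  rw [List.getElem?_append_right (by omega), List.getElem?_append_left (by omega),
    List.getElem?_append_right (by omega), List.getElem?_append_right (by omega),
    List.getElem?_append_left (by omega)]
  congr 1
  omega

theorem flatMap_length (u : List (Fin 3)) : (u.flatMap hm).length = 43 * u.length := by
  induction u with
  | nil => rfl
  | cons a u ih => simp [hm_length, ih]; omega

theorem flatMap_getD (u : List (Fin 3)) (j r : ℕ) (hj : j < u.length) (hr : r < 43) :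
    (u.flatMap hm).getD (43 * j + r) 0 = gm (u.getD j 0) r := by
  induction u generalizing j with
  | nil => simp at hj
  | cons a u ih =>
    simp only [List.flatMap_cons]
    cases j with
    | zero =>
      rw [List.getD_append _ _ _ _ (by rw [hm_length]; omega)]
      simp [gm]
    | succ j =>
      rw [List.getD_append_right _ _ _ _ (by rw [hm_length]; omega), hm_length]
      have := ih j (by simpa using hj)
      rw [show 43 * (j + 1) + r - 43 = 43 * j + r by omega, this]
      simp

theorem short_case {u : List (Fin 3)} (hu : SquareFree u) (hl : u.length ≤ 4) :
    hasSqN 43 (u.flatMap hm) = false := by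
  have key : ∀ a b c d : Fin 3, ∀ t < 5, u = [a, b, c, d].take t →
      hasSqN 43 (u.flatMap hm) = false := by
    intro a b c d t ht h
    rcases short_check a b c d t ht with h1 | h1
    · exact absurd hu (h ▸ hasSq_sound h1)
    · rw [forceW_eq] at h1
      rw [h]; exact h1
  match u, hl with
  | [], _ => exact key 0 0 0 0 0 (by omega) rfl
  | [a], _ => exact key a 0 0 0 1 (by omega) rfl
  | [a, b], _ => exact key a b 0 0 2 (by omega) rfl
  | [a, b, c], _ => exact key a b c 0 3 (by omega) rfl
  | [a, b, c, d], _ => exact key a b c d 4 (by omega) rfl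
  | a :: b :: c :: d :: e :: l, hl => simp at hl; omega

theorem shortOK_index {l : List (Fin 3)} (h : hasSqN 43 l = false) (s p : ℕ) (hs : s < 43)
    (hp : 0 < p) (hl : s + 2 * p ≤ l.length)
    (heq : ∀ i < p, l.getD (s + i) 0 = l.getD (s + p + i) 0) : False := by
  have hx : (l.drop s).take p = (l.drop (s + p)).take p := by
    apply List.ext_getElem
    · simp; omega
    · intro i h1 h2
      simp only [List.length_take, List.length_drop] at h1 h2
      have := heq i (by omega)
      rw [List.getD_eq_getElem _ _ (by omega), List.getD_eq_getElem _ _ (by omega)] at this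
      simpa using this
  rw [(hasSqN_iff 43 l).mpr ⟨s, hs, p, hp, hl, hx⟩] at h
  simp at h

/-- The morphism preserves square-freeness. -/
theorem hm_squareFree {u : List (Fin 3)} (hu : SquareFree u) : SquareFree (u.flatMap hm) := by
  intro x hx hxx
  obtain ⟨s, p, hp, hs, heq⟩ := exists_index hx hxx
  rw [flatMap_length] at hs
  obtain ⟨a, r, hr, rfl⟩ : ∃ a r, r < 43 ∧ s = 43 * a + r :=
    ⟨s / 43, s % 43, Nat.mod_lt _ (by omega), by omega⟩
  by_cases hsmall : p < 48
  · -- short squares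
    have hv : ((u.drop a).take 4) <:+: u :=
      (List.take_prefix _ _).isInfix.trans (List.drop_suffix _ _).isInfix
    have hlen : ((u.drop a).take 4).length = min 4 (u.length - a) := by simp
    have hget : ∀ i < 43 * min 4 (u.length - a),
        (((u.drop a).take 4).flatMap hm).getD i 0 = (u.flatMap hm).getD (43 * a + i) 0 := by
      intro i hi
      have e1 := flatMap_getD ((u.drop a).take 4) (i / 43) (i % 43) (by omega)
        (Nat.mod_lt _ (by omega))
      have e2 := flatMap_getD u (a + i / 43) (i % 43) (by omega) (Nat.mod_lt _ (by omega))
      rw [show 43 * (i / 43) + i % 43 = i by omega] at e1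
      rw [show 43 * (a + i / 43) + i % 43 = 43 * a + i by omega] at e2
      rw [e1, e2]
      congr 1
      simp only [List.getD_eq_getElem?_getD]
      rw [List.getElem?_take_of_lt (by omega), List.getElem?_drop]
    refine shortOK_index (short_case (hu.of_infix hv) (by omega)) r p hr hp ?_ ?_
    · rw [flatMap_length, hlen]; omega
    · intro i hi
      rw [hget _ (by omega), hget _ (by omega)]
      have := heq i hi
      rwa [show 43 * a + r + p + i = 43 * a + (r + p + i) by omega, add_assoc] at this
  · -- long squares: synchronisation
    obtain ⟨q, rfl⟩ : ∃ q, p = 43 * q := by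
      obtain ⟨j, hj⟩ : ∃ j, j = (43 * a + r + 42) / 43 := ⟨_, rfl⟩
      obtain ⟨b, r', hr', hb⟩ : ∃ b r', r' < 43 ∧ 43 * j + p = 43 * b + r' :=
        ⟨(43 * j + p) / 43, (43 * j + p) % 43, Nat.mod_lt _ (by omega), by omega⟩
      have h0 : r' = 0 := by
        refine gm_sync (u.getD b 0) (u.getD (b + 1) 0) r' hr' ?_
        intro i hi
        have e1 := flatMap_getD u j i (by omega) (by omega)
        rw [gm_em _ i hi] at e1
        have e2 := heq (43 * j + i - (43 * a + r)) (by omega)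
        rw [show 43 * a + r + (43 * j + i - (43 * a + r)) = 43 * j + i by omega,
          show 43 * a + r + p + (43 * j + i - (43 * a + r)) = 43 * b + (r' + i) by omega] at e2
        rw [← e1, e2]
        split_ifs with hc
        · rw [flatMap_getD u b (r' + i) (by omega) hc]
        · rw [← flatMap_getD u (b + 1) (r' + i - 43) (by omega) (by omega)]
          congr 1
          omega
      exact ⟨b - j, by omega⟩
    by_cases hr29 : r ≤ 29
    · refine hu.index a q (by omega) (by omega) ?_
      intro t ht
      apply gm_suffix_inj
      intro i hi hi'
      rw [← flatMap_getD u _ i (by omega) hi, ← flatMap_getD u _ i (by omega) hi]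
      have := heq (43 * t + i - r) (by omega)
      rwa [show 43 * a + r + (43 * t + i - r) = 43 * (a + t) + i by omega,
        show 43 * a + r + 43 * q + (43 * t + i - r) = 43 * (a + q + t) + i by omega] at this
    · refine hu.index (a + 1) q (by omega) (by omega) ?_
      intro t ht
      apply gm_prefix_inj
      intro i hi
      rw [← flatMap_getD u _ i (by omega) (by omega), ← flatMap_getD u _ i (by omega) (by omega)]
      have := heq (43 * t + 43 + i - r) (by omega)
      rwa [show 43 * a + r + (43 * t + 43 + i - r) = 43 * (a + 1 + t) + i by omega,
        show 43 * a + r + 43 * q + (43 * t + 43 + i - r) = 43 * (a + 1 + q + t) + i by omega]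
        at this

/-! ### Insertions -/

/-- No interior insertion is square-free. -/
def Blocked (w : List (Fin 3)) : Prop :=
  ∀ c, 0 < c → c < w.length → ∀ x, ¬ SquareFree (w.take c ++ x :: w.drop c)

theorem blocked_base (a : Fin 3) : Blocked (hm a ++ mkr) := by
  intro c hc hc' x
  have h := insCheck_sound x [] _ (hm_ext_check a x) c hc hc'
  simpa using h

theorem blocked_glue {P M S : List (Fin 3)} (hM : M ≠ []) (h1 : Blocked (P ++ M))
    (h2 : Blocked (M ++ S)) : Blocked (P ++ (M ++ S)) := by
  have hM' := List.length_pos_iff.mpr hM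
  intro c hc hc' x hsf
  by_cases hlt : c < (P ++ M).length
  · refine h1 c hc hlt x (hsf.of_infix ⟨[], S, ?_⟩)
    have e : P ++ (M ++ S) = (P ++ M) ++ S := by simp
    rw [e, List.take_append_of_le_length hlt.le, List.drop_append_of_le_length hlt.le]
    simp
  · simp only [List.length_append] at hlt hc'
    refine h2 (c - P.length) (by omega) (by simp; omega) x (hsf.of_infix ⟨P, [], ?_⟩)
    obtain ⟨d, rfl⟩ : ∃ d, c = P.length + d := ⟨c - P.length, by omega⟩
    rw [List.take_length_add_append, List.drop_length_add_append]
    simp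

theorem em_prefix_flatMap (u : List (Fin 3)) : mkr <+: u.flatMap hm ++ mkr := by
  cases u with
  | nil => simp
  | cons a u =>
    simp only [List.flatMap_cons, List.append_assoc]
    exact (em_prefix a).trans (List.prefix_append _ _)

theorem blocked_flatMap (u : List (Fin 3)) (hu : u ≠ []) : Blocked (u.flatMap hm ++ mkr) := by
  induction u with
  | nil => exact absurd rfl hu
  | cons a u ih =>
    by_cases h : u = []
    · subst h
      simpa using blocked_base a
    · have h1 := ih h
      obtain ⟨S, hS⟩ := em_prefix_flatMap u
      simp only [List.flatMap_cons, List.append_assoc]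
      rw [← hS] at h1 ⊢
      exact blocked_glue (by simp [mkr]) (blocked_base a) h1

theorem exists_long (n : ℕ) : ∃ u : List (Fin 3), n ≤ u.length ∧ SquareFree u := by
  induction n with
  | zero => exact ⟨[], by simp, fun x hx h => hx (by simpa using h)⟩
  | succ n ih =>
    obtain ⟨u, hn, hu⟩ := ih
    by_cases h : u = []
    · refine ⟨[0], ?_, ?_⟩
      · subst h; simp at hn; simp [hn]
      · intro x hx h
        have h1 := h.length_le
        have h2 := List.length_pos_iff.mpr hx
        simp at h1
        omega
    · refine ⟨u.flatMap hm, ?_, hm_squareFree hu⟩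
      have := List.length_pos_iff.mpr h
      rw [flatMap_length]; omega

/-- There exist arbitrarily long nearly extremal square-free words over a
3-letter alphabet. -/
theorem arbitrarily_long_nearly_extremal_words (n : ℕ) :
    ∃ W : List (Fin 3), n ≤ W.length ∧ SquareFree W ∧ NearlyExtremal W := by
  obtain ⟨u, hn, hu⟩ := exists_long (n + 2)
  have hne : u ≠ [] := by intro h; subst h; simp at hn
  have hsplit := List.dropLast_append_getLast hne
  have hlen : u.dropLast.length = u.length - 1 := List.length_dropLast
  have hsf : SquareFree (u.dropLast.flatMap hm ++ mkr) := by
    refine (hm_squareFree hu).of_infix (List.IsPrefix.isInfix ?_)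
    conv_rhs => rw [← hsplit]
    simp only [List.flatMap_append, List.flatMap_singleton]
    exact (List.prefix_append_right_inj _).mpr (em_prefix _)
  refine ⟨u.dropLast.flatMap hm ++ mkr, ?_, hsf, hsf, ?_⟩
  · rw [List.length_append, flatMap_length]; omega
  · intro w' w'' x hw h1 h2
    have hb := blocked_flatMap u.dropLast (by intro h; simp [h] at hlen; omega)
    rw [hw] at hb
    have h1' := List.length_pos_iff.mpr h1
    have h2' := List.length_pos_iff.mpr h2
    have := hb w'.length h1' (by simp; omega) x
    simpa using this
end
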